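/- The worst-case absolute-error distortion of the cut-query estimator over all graph databases and all cuts satisfies sup over x ∈ {0,1}^{V×V} and disjoint S, T ⊆ V of E_{Y∼E(x)}[|q̂_{S,T}(Y) − q_{S,T}(x)|] ≤ ((1+e^{−ε})/(1−e^{−ε}))·|V|; in particular, the minimax absolute-error distortion for ε-differentially private cut function release is at most ((1+e^{−ε})/(1−e^{−ε}))·|V|. -/

import Mathlib

open Finset

/-- Hamming distance between graph databases (adjacency indicators on `V × V`). -/
def hamG {V : Type*} [Fintype V] [DecidableEq V] (x y : V × V → Bool) : ℕ :=
  (Finset.univ.filter fun e => x e ≠ y e).card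

/-- Two graph databases are neighbors if they differ in exactly one entry. -/
def NeighborG {V : Type*} [Fintype V] [DecidableEq V] (x x' : V × V → Bool) : Prop :=
  (Finset.univ.filter fun e => x e ≠ x' e).card = 1

/-- The pmf of the mechanism `E` on graph databases. -/
noncomputable def pEG {V : Type*} [Fintype V] [DecidableEq V] (ε : ℝ) (x y : V × V → Bool) : ℝ :=
  Real.exp (-ε * (hamG x y : ℝ)) / (1 + Real.exp (-ε)) ^ (Fintype.card V ^ 2)

/-- The cut query `q_{S,T}(x) = |{(i,j) ∈ S × T : x_{i,j} = 1}|`. -/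
def cutQ {V : Type*} [Fintype V] [DecidableEq V] (S T : Finset V) (x : V × V → Bool) : ℝ :=
  ∑ e ∈ S ×ˢ T, (if x e then 1 else 0)

/-- The cut-query estimator. -/
noncomputable def cutEst {V : Type*} [Fintype V] [DecidableEq V] (ε : ℝ) (S T : Finset V)
    (y : V × V → Bool) : ℝ :=
  ((1 + Real.exp (-ε)) / (1 - Real.exp (-ε))) * cutQ S T y
    - (Real.exp (-ε) / (1 - Real.exp (-ε))) * ((S.card : ℝ) * T.card)

/-- The one-entry kernel of the mechanism `E`, written with `r = exp (-ε)`. -/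
noncomputable def entryKernel (r : ℝ) (a b : Bool) : ℝ := (if a = b then 1 else r) / (1 + r)

/-- The contribution of a single entry to the error of the cut-query estimator. -/
noncomputable def entryError (r : ℝ) (a b : Bool) : ℝ :=
  (1 + r) / (1 - r) * (if b then 1 else 0) - r / (1 - r) - (if a then 1 else 0)

lemma sum_entryKernel {r : ℝ} (hr : 0 < r) (a : Bool) : ∑ b, entryKernel r a b = 1 := by
  have : 1 + r ≠ 0 := by positivity
  cases a <;> simp [entryKernel] <;> field_simp <;> ring

lemma sum_entryKernel_mul_entryError {r : ℝ} (hr : 0 < r) (hr1 : r < 1) (a : Bool) :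
    ∑ b, entryKernel r a b * entryError r a b = 0 := by
  have : 1 + r ≠ 0 := by positivity
  have : 1 - r ≠ 0 := by linarith
  cases a <;> simp [entryKernel, entryError] <;> field_simp <;> ring

lemma sum_entryKernel_mul_entryError_sq {r : ℝ} (hr : 0 < r) (hr1 : r < 1) (a : Bool) :
    ∑ b, entryKernel r a b * entryError r a b * entryError r a b = r / (1 - r) ^ 2 := by
  have : 1 + r ≠ 0 := by positivity
  have : 1 - r ≠ 0 := by linarith
  cases a <;> simp [entryKernel, entryError] <;> field_simp <;> ring

lemma sum_prod_apply {ι : Type*} [Fintype ι] [DecidableEq ι] (F : ι → Bool → ℝ) :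
    ∑ y : ι → Bool, ∏ i, F i (y i) = ∏ i, ∑ b, F i b := by
  rw [Finset.prod_univ_sum, Fintype.piFinset_univ]

/-- Under a product distribution with centred `g i`, the `g i` are uncorrelated. -/
lemma sum_prod_mul_mul {ι : Type*} [Fintype ι] [DecidableEq ι] (w g : ι → Bool → ℝ) (v : ℝ)
    (h1 : ∀ i, ∑ b, w i b = 1) (h0 : ∀ i, ∑ b, w i b * g i b = 0)
    (h2 : ∀ i, ∑ b, w i b * g i b * g i b = v) (e f : ι) :
    ∑ y : ι → Bool, (∏ i, w i (y i)) * (g e (y e) * g f (y f)) = if e = f then v else 0 := by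
  have key : ∀ y : ι → Bool, (∏ i, w i (y i)) * (g e (y e) * g f (y f)) =
      ∏ i, w i (y i) * (if i = e then g i (y i) else 1) * (if i = f then g i (y i) else 1) := by
    intro y
    rw [Finset.prod_mul_distrib, Finset.prod_mul_distrib]
    simp [mul_assoc]
  simp_rw [key]
  rw [sum_prod_apply fun i b => w i b * (if i = e then g i b else 1) * (if i = f then g i b else 1)]
  split_ifs with hef
  · subst hef
    rw [Finset.prod_eq_single e]
    · simpa using h2 e
    · intro i _ hi
      simpa [hi] using h1 i
    · simp
  · apply Finset.prod_eq_zero (Finset.mem_univ e)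
    simpa [hef] using h0 e

lemma sum_prod_mul_sum_sq {ι : Type*} [Fintype ι] [DecidableEq ι] (w g : ι → Bool → ℝ) (v : ℝ)
    (h1 : ∀ i, ∑ b, w i b = 1) (h0 : ∀ i, ∑ b, w i b * g i b = 0)
    (h2 : ∀ i, ∑ b, w i b * g i b * g i b = v) (A : Finset ι) :
    ∑ y : ι → Bool, (∏ i, w i (y i)) * (∑ e ∈ A, g e (y e)) ^ 2 = A.card * v := by
  simp_rw [sq, Finset.sum_mul_sum, Finset.mul_sum]
  rw [Finset.sum_comm]
  have : ∀ e ∈ A, ∑ y : ι → Bool, ∑ f ∈ A, (∏ i, w i (y i)) * (g e (y e) * g f (y f)) = v := by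
    intro e he
    rw [Finset.sum_comm]
    simp_rw [sum_prod_mul_mul w g v h1 h0 h2]
    simp [he]
  rw [Finset.sum_congr rfl this]
  simp

section

variable {V : Type*} [Fintype V] [DecidableEq V]

lemma pEG_eq_prod (ε : ℝ) (x y : V × V → Bool) :
    pEG ε x y = ∏ e, entryKernel (Real.exp (-ε)) (x e) (y e) := by
  have h : ∀ e, (if x e = y e then (1 : ℝ) else Real.exp (-ε)) =
      if x e ≠ y e then Real.exp (-ε) else 1 := fun e => by
    by_cases h : x e = y e <;> simp [h]
  simp only [entryKernel, Finset.prod_div_distrib, h]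
  rw [← Finset.prod_filter]
  rw [Finset.prod_const, ← Real.exp_nat_mul, mul_comm]
  simp [pEG, hamG, sq]

lemma pEG_nonneg (ε : ℝ) (x y : V × V → Bool) : 0 ≤ pEG ε x y := by
  unfold pEG
  positivity

lemma sum_pEG (ε : ℝ) (x : V × V → Bool) : ∑ y, pEG ε x y = 1 := by
  simp_rw [pEG_eq_prod]
  rw [sum_prod_apply fun e b => entryKernel (Real.exp (-ε)) (x e) b]
  simp only [sum_entryKernel (Real.exp_pos (-ε)), Finset.prod_const_one]

lemma hamG_le_hamG_add_one {x x' : V × V → Bool} (h : NeighborG x x') (y : V × V → Bool) :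
    hamG x' y ≤ hamG x y + 1 := by
  unfold hamG
  rw [← show _ = 1 from h]
  refine le_trans (Finset.card_le_card ?_) (Finset.card_union_le _ _)
  intro e
  simp only [Finset.mem_filter, Finset.mem_union, Finset.mem_univ, true_and]
  grind

lemma pEG_le_exp_mul_pEG {ε : ℝ} (hε : 0 < ε) {x x' : V × V → Bool} (h : NeighborG x x')
    (y : V × V → Bool) : pEG ε x y ≤ Real.exp ε * pEG ε x' y := by
  unfold pEG
  rw [← mul_div_assoc, ← Real.exp_add]
  have : (hamG x' y : ℝ) ≤ hamG x y + 1 := mod_cast hamG_le_hamG_add_one h y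
  gcongr
  nlinarith

lemma cutEst_sub_cutQ {ε : ℝ} (S T : Finset V) (x y : V × V → Bool) :
    cutEst ε S T y - cutQ S T x = ∑ e ∈ S ×ˢ T, entryError (Real.exp (-ε)) (x e) (y e) := by
  simp only [cutEst, cutQ, entryError, Finset.sum_sub_distrib, ← Finset.mul_sum]
  simp [mul_comm]

/-- The expected absolute error of the estimator is at most half of the claimed distortion. -/
lemma two_mul_expected_error_le {ε : ℝ} (hε : 0 < ε) (S T : Finset V) (x : V × V → Bool) :
    2 * ∑ y, pEG ε x y * |cutEst ε S T y - cutQ S T x| ≤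
      (1 + Real.exp (-ε)) / (1 - Real.exp (-ε)) * (Fintype.card V : ℝ) := by
  have hr : 0 < Real.exp (-ε) := Real.exp_pos _
  have hr1 : Real.exp (-ε) < 1 := by simpa using hε
  have hvar : ∑ y, pEG ε x y * |cutEst ε S T y - cutQ S T x| ^ 2 =
      (S ×ˢ T).card * (Real.exp (-ε) / (1 - Real.exp (-ε)) ^ 2) := by
    simp_rw [sq_abs, cutEst_sub_cutQ, pEG_eq_prod]
    exact sum_prod_mul_sum_sq (fun e => entryKernel _ (x e)) (fun e => entryError _ (x e)) _
      (fun _ => sum_entryKernel hr _) (fun _ => sum_entryKernel_mul_entryError hr hr1 _)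
      (fun _ => sum_entryKernel_mul_entryError_sq hr hr1 _) _
  have hcs : (∑ y, pEG ε x y * |cutEst ε S T y - cutQ S T x|) ^ 2 ≤
      (∑ y, pEG ε x y) * ∑ y, pEG ε x y * |cutEst ε S T y - cutQ S T x| ^ 2 :=
    Finset.sum_sq_le_sum_mul_sum_of_sq_le_mul _ (fun y _ => pEG_nonneg ε x y)
      (fun y _ => mul_nonneg (pEG_nonneg ε x y) (sq_nonneg _)) (fun y _ => le_of_eq (by ring))
  rw [sum_pEG, one_mul, hvar, Finset.card_product] at hcs
  have hcard : (((S.card * T.card : ℕ)) : ℝ) ≤ (Fintype.card V : ℝ) ^ 2 := by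
    rw [sq]
    exact mod_cast Nat.mul_le_mul S.card_le_univ T.card_le_univ
  generalize Real.exp (-ε) = r at *
  have h1r : 0 < 1 - r := by linarith
  refine le_of_sq_le_sq ?_ (by positivity)
  calc _ = 4 * (∑ y, pEG ε x y * |cutEst ε S T y - cutQ S T x|) ^ 2 := by ring
    _ ≤ 4 * ((Fintype.card V : ℝ) ^ 2 * (r / (1 - r) ^ 2)) := by
      have := mul_le_mul_of_nonneg_right hcard (show 0 ≤ r / (1 - r) ^ 2 by positivity)
      linarith
    _ = (Fintype.card V : ℝ) ^ 2 / (1 - r) ^ 2 * (4 * r) := by ring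
    _ ≤ (Fintype.card V : ℝ) ^ 2 / (1 - r) ^ 2 * (1 + r) ^ 2 := by
      gcongr
      nlinarith [sq_nonneg (1 - r)]
    _ = _ := by rw [mul_pow, div_pow]; ring

/-- Projecting the estimator to the range of the query at most doubles the error. -/
lemma exists_range_valued_estimator (ε : ℝ) (S T : Finset V) :
    ∃ q : (V × V → Bool) → ℝ, (∀ y, ∃ x0 : V × V → Bool, q y = cutQ S T x0) ∧
      ∀ x y, |q y - cutQ S T x| ≤ 2 * |cutEst ε S T y - cutQ S T x| := by
  choose z hz using fun y => Finite.exists_min fun x0 => |cutEst ε S T y - cutQ S T x0|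
  refine ⟨fun y => cutQ S T (z y), fun y => ⟨z y, rfl⟩, fun x y => ?_⟩
  have h := abs_sub_le (cutQ S T (z y)) (cutEst ε S T y) (cutQ S T x)
  rw [abs_sub_comm (cutQ S T (z y)) (cutEst ε S T y)] at h
  linarith [hz y x]

end

/-- The worst-case absolute-error distortion of the cut-query estimator over all graph
databases and all cuts is at most `((1+e^{-ε})/(1-e^{-ε})) |V|`; in particular the minimax
absolute-error distortion for `ε`-differentially private cut function release is at most
`((1+e^{-ε})/(1-e^{-ε})) |V|`. -/
theorem stmt19 {V : Type*} [Fintype V] [DecidableEq V] (ε : ℝ) (hε : 0 < ε) :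
    (⨆ x : V × V → Bool, ⨆ ST : {ST : Finset V × Finset V // Disjoint ST.1 ST.2},
        ∑ y : V × V → Bool, pEG ε x y * |cutEst ε ST.1.1 ST.1.2 y - cutQ ST.1.1 ST.1.2 x|)
      ≤ ((1 + Real.exp (-ε)) / (1 - Real.exp (-ε))) * (Fintype.card V : ℝ) ∧
    (⨅ M : {p : (V × V → Bool) → (V × V → Bool) → ℝ //
        (∀ x y, 0 ≤ p x y) ∧ (∀ x, ∑ y, p x y = 1) ∧
        ∀ x x', NeighborG x x' → ∀ y, p x y ≤ Real.exp ε * p x' y},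
      ⨆ x : V × V → Bool, ⨆ ST : {ST : Finset V × Finset V // Disjoint ST.1 ST.2},
        ⨅ q : {q : (V × V → Bool) → ℝ //
            ∀ y, ∃ x0 : V × V → Bool, q y = cutQ ST.1.1 ST.1.2 x0},
          ∑ y : V × V → Bool, M.1 x y * |q.1 y - cutQ ST.1.1 ST.1.2 x|)
      ≤ ((1 + Real.exp (-ε)) / (1 - Real.exp (-ε))) * (Fintype.card V : ℝ) := by
  have hr1 : Real.exp (-ε) < 1 := by simpa using hε
  have hB : 0 ≤ (1 + Real.exp (-ε)) / (1 - Real.exp (-ε)) * (Fintype.card V : ℝ) := by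
    have : 0 < 1 - Real.exp (-ε) := by linarith
    positivity
  constructor
  · refine Real.iSup_le (fun x => Real.iSup_le (fun ST => ?_) hB) hB
    have h0 : 0 ≤ ∑ y, pEG ε x y * |cutEst ε ST.1.1 ST.1.2 y - cutQ ST.1.1 ST.1.2 x| :=
      Finset.sum_nonneg fun y _ => mul_nonneg (pEG_nonneg ε x y) (abs_nonneg _)
    linarith [two_mul_expected_error_le hε ST.1.1 ST.1.2 x]
  · refine (ciInf_le ⟨0, ?_⟩ ⟨pEG ε, pEG_nonneg ε, sum_pEG ε,
      fun x x' h y => pEG_le_exp_mul_pEG hε h y⟩).trans ?_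
    · rintro _ ⟨M, rfl⟩
      exact Real.iSup_nonneg fun x => Real.iSup_nonneg fun ST => Real.iInf_nonneg fun q =>
        Finset.sum_nonneg fun y _ => mul_nonneg (M.2.1 x y) (abs_nonneg _)
    · refine Real.iSup_le (fun x => Real.iSup_le (fun ST => ?_) hB) hB
      obtain ⟨q, hq, hle⟩ := exists_range_valued_estimator ε ST.1.1 ST.1.2
      refine (ciInf_le ⟨0, ?_⟩ ⟨q, hq⟩).trans ?_
      · rintro _ ⟨q, rfl⟩
        exact Finset.sum_nonneg fun y _ => mul_nonneg (pEG_nonneg ε x y) (abs_nonneg _)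
      · refine le_trans ?_ (two_mul_expected_error_le hε ST.1.1 ST.1.2 x)
        rw [Finset.mul_sum]
        refine Finset.sum_le_sum fun y _ => ?_
        rw [mul_left_comm]
        exact mul_le_mul_of_nonneg_left (hle x y) (pEG_nonneg ε x y)
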